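/- arXiv:1810.01546 — 2 statements merged into one kernel-verified Lean document; each statement's English description precedes it below -/
import Mathlib

section
/- Let k ≥ 1 and let β, γ : Fin k → ℝ → ℝ be functions such that each β j and γ j is differentiable at t₀, and such that for all t in some neighborhood of t₀ and all j, β j t ∈ (0, π) and γ j t ∈ (0, π). Suppose that for all t in that neighborhood, ∏_{j} (sin (β j t) / sin (γ j t)) = 1. Then ∑_{j} ( (cos (β j t₀) / sin (β j t₀)) · (deriv (β j) t₀) − (cos (γ j t₀) / sin (γ j t₀)) · (deriv (γ j) t₀) ) = 0. -/
open Real Filter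

theorem hasDerivAt_log_sin {f : ℝ → ℝ} {t : ℝ} (hf : DifferentiableAt ℝ f t)
    (h : Real.sin (f t) ≠ 0) :
    HasDerivAt (fun s => Real.log (Real.sin (f s)))
      (Real.cos (f t) / Real.sin (f t) * deriv f t) t := by
  convert hf.hasDerivAt.sin.log h using 1
  ring

theorem cotangent_equation_at_vertex (k : ℕ) (hk : 1 ≤ k)
    (β γ : Fin k → ℝ → ℝ) (t₀ : ℝ)
    (hβ : ∀ j, DifferentiableAt ℝ (β j) t₀)
    (hγ : ∀ j, DifferentiableAt ℝ (γ j) t₀)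
    (hmem : ∀ᶠ t in nhds t₀, ∀ j, β j t ∈ Set.Ioo 0 π ∧ γ j t ∈ Set.Ioo 0 π)
    (hprod : ∀ᶠ t in nhds t₀, ∏ j, Real.sin (β j t) / Real.sin (γ j t) = 1) :
    ∑ j, ((Real.cos (β j t₀) / Real.sin (β j t₀)) * deriv (β j) t₀
        - (Real.cos (γ j t₀) / Real.sin (γ j t₀)) * deriv (γ j) t₀) = 0 := by
  have hderiv : HasDerivAt
      (fun t => ∑ j, (Real.log (Real.sin (β j t)) - Real.log (Real.sin (γ j t))))
      (∑ j, ((Real.cos (β j t₀) / Real.sin (β j t₀)) * deriv (β j) t₀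
        - (Real.cos (γ j t₀) / Real.sin (γ j t₀)) * deriv (γ j) t₀)) t₀ :=
    HasDerivAt.fun_sum fun j _ =>
      (hasDerivAt_log_sin (hβ j) (sin_pos_of_mem_Ioo (hmem.self_of_nhds j).1).ne').sub
        (hasDerivAt_log_sin (hγ j) (sin_pos_of_mem_Ioo (hmem.self_of_nhds j).2).ne')
  have hzero : (fun t => ∑ j, (Real.log (Real.sin (β j t)) - Real.log (Real.sin (γ j t))))
      =ᶠ[nhds t₀] fun _ => 0 := by
    filter_upwards [hmem, hprod] with t ht hp
    have hβpos j := sin_pos_of_mem_Ioo (ht j).1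
    have hγpos j := sin_pos_of_mem_Ioo (ht j).2
    rw [← Real.log_one, ← hp,
      Real.log_prod fun j _ => (div_pos (hβpos j) (hγpos j)).ne']
    exact Finset.sum_congr rfl fun j _ =>
      (Real.log_div (hβpos j).ne' (hγpos j).ne').symm
  exact hderiv.unique ((hasDerivAt_const t₀ 0).congr_of_eventuallyEq hzero)
end

section
/- Let A, B, C : ℝ → Matrix (Fin 3) (Fin 3) ℝ be differentiable at t₀, with derivatives A'(t₀) = S(ω_a) * A(t₀), B'(t₀) = S(ω_b) * B(t₀), C'(t₀) = S(ω_c) * C(t₀), where S(ω) denotes the cross-product matrix of ω ∈ ℝ³, and suppose A(t₀) and B(t₀) are orthogonal with determinant 1. Then the product t ↦ A(t) * B(t) * C(t) is differentiable at t₀ with derivative S(ω_d) * (A(t₀) * B(t₀) * C(t₀)), where ω_d = ω_a + A(t₀).mulVec ω_b + (A(t₀) * B(t₀)).mulVec ω_c. -/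
open Matrix

attribute [local instance] Matrix.normedAddCommGroup Matrix.normedSpace

/-- The cross-product (skew-symmetric) matrix of a vector `ω ∈ ℝ³`. -/
def crossMatrix (ω : Fin 3 → ℝ) : Matrix (Fin 3) (Fin 3) ℝ :=
  Matrix.of ![![0, -ω 2, ω 1], ![ω 2, 0, -ω 0], ![-ω 1, ω 0, 0]]

theorem crossMatrix_add (v w : Fin 3 → ℝ) :
    crossMatrix (v + w) = crossMatrix v + crossMatrix w := by
  ext i j
  fin_cases i <;> fin_cases j <;> simp [crossMatrix] <;> ring

theorem transpose_mul_crossMatrix_mulVec_mul (M : Matrix (Fin 3) (Fin 3) ℝ) (w : Fin 3 → ℝ) :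
    Mᵀ * crossMatrix (M *ᵥ w) * M = M.det • crossMatrix w := by
  ext i j
  fin_cases i <;> fin_cases j <;>
    simp [crossMatrix, Matrix.mul_apply, Matrix.mulVec, dotProduct, Fin.sum_univ_three,
      Matrix.det_fin_three] <;> ring

/-- A rotation intertwines the cross-product matrices of a vector and of its image. -/
theorem crossMatrix_mulVec_mul {R : Matrix (Fin 3) (Fin 3) ℝ} (horth : Rᵀ * R = 1)
    (hdet : R.det = 1) (w : Fin 3 → ℝ) :
    crossMatrix (R *ᵥ w) * R = R * crossMatrix w := by
  have h := transpose_mul_crossMatrix_mulVec_mul R w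
  rw [hdet, one_smul] at h
  rw [← h, ← Matrix.mul_assoc, ← Matrix.mul_assoc, mul_eq_one_comm.mp horth, Matrix.one_mul]

theorem HasDerivAt.matrix_mul {l m n : Type*} [Fintype l] [Fintype m] [Fintype n]
    {M : ℝ → Matrix l m ℝ} {N : ℝ → Matrix m n ℝ} {M' : Matrix l m ℝ} {N' : Matrix m n ℝ} {t : ℝ}
    (hM : HasDerivAt M M' t) (hN : HasDerivAt N N' t) :
    HasDerivAt (fun s => M s * N s) (M' * N t + M t * N') t := by
  refine hasDerivAt_pi.mpr fun i => hasDerivAt_pi.mpr fun k => ?_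
  have hentry (j : m) : HasDerivAt (fun s => M s i j * N s j k)
      (M' i j * N t j k + M t i j * N' j k) t :=
    (hasDerivAt_pi.mp (hasDerivAt_pi.mp hM i) j).mul (hasDerivAt_pi.mp (hasDerivAt_pi.mp hN j) k)
  have hsum := HasDerivAt.fun_sum (u := Finset.univ) fun j _ => hentry j
  simpa only [Matrix.mul_apply, Matrix.add_apply, Finset.sum_add_distrib] using hsum

theorem angular_velocity_of_triple_product
    (A B C : ℝ → Matrix (Fin 3) (Fin 3) ℝ) (t₀ : ℝ)
    (ωa ωb ωc : Fin 3 → ℝ)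
    (hA : HasDerivAt A (crossMatrix ωa * A t₀) t₀)
    (hB : HasDerivAt B (crossMatrix ωb * B t₀) t₀)
    (hC : HasDerivAt C (crossMatrix ωc * C t₀) t₀)
    (hAorth : (A t₀)ᵀ * A t₀ = 1) (hAdet : (A t₀).det = 1)
    (hBorth : (B t₀)ᵀ * B t₀ = 1) (hBdet : (B t₀).det = 1) :
    HasDerivAt (fun t => A t * B t * C t)
      (crossMatrix (ωa + (A t₀).mulVec ωb + (A t₀ * B t₀).mulVec ωc)
        * (A t₀ * B t₀ * C t₀)) t₀ := by
  have hBC := crossMatrix_mulVec_mul hBorth hBdet ωc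
  have hAB := crossMatrix_mulVec_mul hAorth hAdet ωb
  have hABC := crossMatrix_mulVec_mul hAorth hAdet (B t₀ *ᵥ ωc)
  convert (hA.matrix_mul hB).matrix_mul hC using 1
  rw [crossMatrix_add, crossMatrix_add, ← Matrix.mulVec_mulVec]
  calc
    _ = crossMatrix ωa * A t₀ * B t₀ * C t₀ + crossMatrix (A t₀ *ᵥ ωb) * A t₀ * B t₀ * C t₀
        + crossMatrix (A t₀ *ᵥ (B t₀ *ᵥ ωc)) * A t₀ * B t₀ * C t₀ := by noncomm_ring
    _ = crossMatrix ωa * A t₀ * B t₀ * C t₀ + A t₀ * crossMatrix ωb * B t₀ * C t₀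
        + A t₀ * (crossMatrix (B t₀ *ᵥ ωc) * B t₀) * C t₀ := by
      rw [hAB, hABC, Matrix.mul_assoc (A t₀) (crossMatrix (B t₀ *ᵥ ωc))]
    _ = _ := by rw [hBC]; noncomm_ring
end
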